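/- arXiv:1604.07710 — 10 statements merged into one kernel-verified Lean document; each statement's English description precedes it below -/
import Mathlib

section
/- Let q be a prime power, n a nonnegative integer, and α_{n−1}, β_{n−1}, α_n, β_n ∈ F_q with α_n ≠ 0 and α_{n−1}·β_n − α_n·β_{n−1} ≠ 0. Let F : F_q → F_q be any map such that F(c) = (α_{n−1}·c + β_{n−1})/(α_n·c + β_n) + c holds for at least q − n distinct elements c ∈ F_q (in particular each such c satisfies α_n·c + β_n ≠ 0). Then the value set V_F = {F(c) : c ∈ F_q} satisfies ⌈(q − n)/2⌉ ≤ #V_F ≤ min{n + ⌊(q+1)/2⌋, q}. -/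
open Finset in
theorem card_fiber_add_div_le_two {K : Type*} [Field K] [DecidableEq K] (γ : K)
    (s : Finset K) (hs : ∀ x ∈ s, x ≠ 0) (v : K) : #{x ∈ s | x + γ / x = v} ≤ 2 := by
  rcases Finset.eq_empty_or_nonempty {x ∈ s | x + γ / x = v} with h | ⟨x, hx⟩
  · simp [h]
  · refine (card_le_card (t := {x, γ / x}) fun y hy => ?_).trans card_le_two
    rw [mem_filter] at hx hy
    have hx0 := hs x hx.1
    have hy0 := hs y hy.1
    have h : y + γ / y = x + γ / x := hy.2.trans hx.2.symm
    field_simp at h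
    have h' : (y - x) * (y * x - γ) = 0 := by linear_combination h
    rw [mem_insert, mem_singleton, eq_div_iff hx0]
    exact (mul_eq_zero.mp h').imp sub_eq_zero.mp sub_eq_zero.mp

open Finset in
theorem card_filter_sq_eq_le_two {K : Type*} [Field K] [DecidableEq K] (γ : K)
    (s : Finset K) : #{x ∈ s | x * x = γ} ≤ 2 := by
  rcases Finset.eq_empty_or_nonempty {x ∈ s | x * x = γ} with h | ⟨x, hx⟩
  · simp [h]
  · refine (card_le_card (t := {x, -x}) fun y hy => ?_).trans card_le_two
    rw [mem_filter] at hx hy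
    rw [mem_insert, mem_singleton]
    exact mul_self_eq_mul_self_iff.mp (hy.2.trans hx.2.symm)

open Finset in
theorem two_mul_card_image_add_div_le {K : Type*} [Field K] [Fintype K] [DecidableEq K]
    {γ : K} (hγ : γ ≠ 0) :
    2 * #((univ.erase (0 : K)).image fun x => x + γ / x) ≤ Fintype.card K + 1 := by
  set s : Finset K := univ.erase 0 with hs
  set h : K → K := fun x => x + γ / x with hh
  set t : Finset K := {x ∈ s | x * x = γ} with ht
  have fiber_bound : ∀ v ∈ s.image h, 2 ≤ #{x ∈ s | h x = v} + #{x ∈ t | h x = v} := by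
    intro v hv
    obtain ⟨x, hx, rfl⟩ := mem_image.mp hv
    have hx0 : x ≠ 0 := ne_of_mem_erase hx
    by_cases hfix : x * x = γ
    · have h1 : 0 < #{y ∈ s | h y = h x} := card_pos.mpr ⟨x, by simp [hx]⟩
      have h2 : 0 < #{y ∈ t | h y = h x} := card_pos.mpr ⟨x, by simp [ht, hx, hfix]⟩
      omega
    · have h1 : 1 < #{y ∈ s | h y = h x} := by
        refine one_lt_card.mpr ⟨x, by simp [hx], γ / x, ?_, ?_⟩
        · rw [mem_filter]
          refine ⟨by simp [hs, hγ, hx0], ?_⟩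
          simp only [hh]
          rw [div_div_cancel₀ hγ, add_comm]
        · rwa [Ne, eq_div_iff hx0]
      omega
  have hsum := sum_le_sum fiber_bound
  rw [sum_const, smul_eq_mul, sum_add_distrib,
    ← card_eq_sum_card_fiberwise (fun x hx => mem_image_of_mem h hx),
    ← card_eq_sum_card_fiberwise
      (fun x hx => mem_image_of_mem h (mem_filter.mp hx).1)] at hsum
  have hcs : #s + 1 = Fintype.card K := by
    rw [hs, card_erase_add_one (mem_univ _), card_univ]
  have htc : #{x ∈ s | x * x = γ} ≤ 2 := card_filter_sq_eq_le_two γ s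
  omega


/-- If `F : F_q → F_q` satisfies `F(c) = (α_{n-1} c + β_{n-1})/(α_n c + β_n) + c` for at least
`q - n` distinct `c` (each with nonzero denominator), where `α_n ≠ 0` and
`α_{n-1} β_n - α_n β_{n-1} ≠ 0`, then `⌈(q-n)/2⌉ ≤ #V_F ≤ min{n + ⌊(q+1)/2⌋, q}`. -/
theorem value_set_bounds_of_rational_approx
    (q n : ℕ) (K : Type*) [Field K] [Fintype K] (hcard : Fintype.card K = q)
    (α' β' α β : K) (hα : α ≠ 0) (hdet : α' * β - α * β' ≠ 0)
    (F : K → K)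
    (hF : q - n ≤ Set.ncard {c : K | α * c + β ≠ 0 ∧
      F c = (α' * c + β') / (α * c + β) + c}) :
    (q - n + 1) / 2 ≤ Set.ncard (Set.range F) ∧
      Set.ncard (Set.range F) ≤ min (n + (q + 1) / 2) q := by
  classical
  subst hcard
  set γ : K := (α * β' - α' * β) / α ^ 2 with hγ_def
  have hγ : γ ≠ 0 := by
    refine div_ne_zero (fun h => hdet ?_) (pow_ne_zero 2 hα)
    linear_combination -h
  set S : Finset K := {c | α * c + β ≠ 0 ∧ F c = (α' * c + β') / (α * c + β) + c} with hS
  have hcardS : Fintype.card K - n ≤ S.card := by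
    rw [← Set.ncard_coe_finset]
    simpa [hS] using hF
  have hrange : (Set.range F).ncard = (Finset.univ.image F).card := by
    rw [← Set.ncard_coe_finset]
    simp
  have shift_ne : ∀ c ∈ S, c + β / α ≠ 0 := by
    intro c hc h
    refine (Finset.mem_filter.mp hc).2.1 ?_
    field_simp at h
    linear_combination h
  have F_eq : ∀ c ∈ S,
      F c = (c + β / α) + γ / (c + β / α) + (α' / α - β / α) := by
    intro c hc
    obtain ⟨-, hden, hFc⟩ := Finset.mem_filter.mp hc
    have hc' : c + β / α = (α * c + β) / α := by field_simp
    rw [hFc, hc', hγ_def]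
    generalize hd : α * c + β = d at hden ⊢
    obtain rfl : β = d - α * c := by rw [← hd]; ring
    field_simp
    ring
  have card_S_le : S.card ≤ 2 * (S.image F).card := by
    refine Finset.card_le_mul_card_image S 2 fun v _ => ?_
    rw [← Finset.card_image_of_injective _ (add_left_injective (β / α))]
    refine (Finset.card_le_card ?_).trans (card_fiber_add_div_le_two γ
      (S.image (· + β / α)) ?_ (v - (α' / α - β / α)))
    · intro x hx
      obtain ⟨c, hc, rfl⟩ := Finset.mem_image.mp hx
      obtain ⟨hcS, hcv⟩ := Finset.mem_filter.mp hc
      refine Finset.mem_filter.mpr ⟨Finset.mem_image_of_mem _ hcS, ?_⟩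
      rw [← hcv, F_eq c hcS]
      ring
    · intro x hx
      obtain ⟨c, hc, rfl⟩ := Finset.mem_image.mp hx
      exact shift_ne c hc
  have image_S_le : 2 * (S.image F).card ≤ Fintype.card K + 1 := by
    refine le_trans (Nat.mul_le_mul_left 2 ?_) (two_mul_card_image_add_div_le hγ)
    rw [← Finset.card_image_of_injective (Finset.image (fun x => x + γ / x) _)
      (add_left_injective (α' / α - β / α))]
    refine Finset.card_le_card fun v hv => ?_
    obtain ⟨c, hc, rfl⟩ := Finset.mem_image.mp hv
    rw [F_eq c hc]
    exact Finset.mem_image_of_mem _ (Finset.mem_image_of_mem _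
      (Finset.mem_erase.mpr ⟨shift_ne c hc, Finset.mem_univ _⟩))
  have image_le : (Finset.univ.image F).card ≤ (S.image F).card + Sᶜ.card := by
    rw [← Finset.union_compl S, Finset.image_union]
    exact (Finset.card_union_le _ _).trans
      (Nat.add_le_add_left Finset.card_image_le _)
  have le_image : (S.image F).card ≤ (Finset.univ.image F).card :=
    Finset.card_le_card (Finset.image_subset_image (Finset.subset_univ S))
  have image_le_card : (Finset.univ.image F).card ≤ Fintype.card K :=
    Finset.card_image_le
  have hcompl := Finset.card_add_card_compl S
  rw [hrange]
  omega
end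

section
/- Let q > 2 be an odd prime power and c_0 ∈ F_q with c_0 ≠ 0. Let F : F_q → F_q be given by F(x) = (c_0·x)^{q−2} + x. Then the value set V_F = {F(c) : c ∈ F_q} has cardinality #V_F = (q + 1 + η(c_0) − η(−c_0))/2. -/
open scoped Classical

/-- The quadratic character: `η(x) = 1` if `x` is a nonzero square, `-1` if `x` is a
nonsquare, and `η(0) = 0`. -/
noncomputable def quadChar {K : Type*} [Field K] (x : K) : ℤ :=
  if x = 0 then 0 else if IsSquare x then 1 else -1

theorem two_mul_card_image_of_involution {α β : Type*} (s : Finset α) (f : α → β)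
    (σ : α → α) (hs : ∀ x ∈ s, σ x ∈ s) (hσ : ∀ x ∈ s, σ (σ x) = x)
    (hf : ∀ x ∈ s, ∀ y ∈ s, f y = f x ↔ y = x ∨ y = σ x) :
    2 * (s.image f).card = s.card + (s.filter fun x => σ x = x).card := by
  have himage : ∀ x ∈ s.filter (fun x => σ x = x), f x ∈ s.image f := fun x hx =>
    Finset.mem_image_of_mem f (Finset.mem_of_mem_filter x hx)
  rw [Finset.card_eq_sum_card_image f s, Finset.card_eq_sum_card_fiberwise himage,
    ← Finset.sum_add_distrib, mul_comm, ← smul_eq_mul, ← Finset.sum_const]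
  refine Finset.sum_congr rfl fun v hv => ?_
  obtain ⟨x, hx, rfl⟩ := Finset.mem_image.1 hv
  have hfiber : s.filter (fun y => f y = f x) = {x, σ x} := by
    ext y
    simp only [Finset.mem_filter, Finset.mem_insert, Finset.mem_singleton]
    constructor
    · rintro ⟨hy, h⟩
      exact (hf x hx y hy).1 h
    · intro h
      have hy : y ∈ s := by
        rcases h with rfl | rfl
        exacts [hx, hs x hx]
      exact ⟨hy, (hf x hx y hy).2 h⟩
  rw [Finset.filter_comm, hfiber]
  by_cases h : σ x = x
  · simp [Finset.filter_singleton, h]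
  · have h' : σ (σ x) ≠ σ x := by rwa [hσ x hx, ne_comm]
    simp [Finset.filter_insert, Finset.filter_singleton, h, h', Finset.card_pair (Ne.symm h)]

theorem quadChar_eq_quadraticChar {K : Type*} [Field K] [Fintype K] (x : K) :
    quadChar x = quadraticChar K x := by
  rw [quadraticChar_apply, quadChar, quadraticCharFun]
  congr

theorem quadChar_inv {K : Type*} [Field K] (x : K) : quadChar x⁻¹ = quadChar x := by
  simp only [quadChar, inv_eq_zero, isSquare_inv]

theorem add_div_eq_add_div_iff {K : Type*} [Field K] {a x y : K} (hx : x ≠ 0) (hy : y ≠ 0) :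
    a / y + y = a / x + x ↔ y = x ∨ y = a / x := by
  have h : a / y + y - (a / x + x) = (y - x) * (y - a / x) / y := by
    field_simp
    ring
  rw [← sub_eq_zero, h, div_eq_zero_iff, mul_eq_zero, sub_eq_zero, sub_eq_zero]
  simp [hy]

theorem two_mul_card_image_div_add {K : Type*} [Field K] [Fintype K] (hK : ringChar K ≠ 2)
    {a : K} (ha : a ≠ 0) :
    2 * (((Finset.univ.erase (0 : K)).image fun x => a / x + x).card : ℤ) =
      Fintype.card K + quadChar a := by
  have hroots : (Finset.univ.erase (0 : K)).filter (fun x => a / x = x) =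
      {x : K | x ^ 2 = a}.toFinset := by
    ext x
    simp only [Finset.mem_filter, Finset.mem_erase, Finset.mem_univ, and_true, Set.mem_toFinset,
      Set.mem_ofPred_eq]
    constructor
    · rintro ⟨hx, h⟩
      rw [div_eq_iff hx] at h
      rw [h, sq]
    · rintro rfl
      have hx : x ≠ 0 := fun h => ha (by simp [h])
      exact ⟨hx, by field_simp⟩
  have hcard := two_mul_card_image_of_involution (Finset.univ.erase (0 : K))
    (fun x => a / x + x) (fun x => a / x) (by simp [ha])
    (fun x _ => div_div_cancel₀ ha)
    (fun x hx y hy => add_div_eq_add_div_iff (Finset.ne_of_mem_erase hx)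
      (Finset.ne_of_mem_erase hy))
  have herase := Finset.card_erase_add_one (Finset.mem_univ (0 : K))
  rw [Finset.card_univ] at herase
  have hsqrt := quadraticChar_card_sqrts hK a
  rw [hroots] at hcard
  rw [← quadChar_eq_quadraticChar] at hsqrt
  zify at hcard herase
  linarith

theorem zero_mem_image_div_add_iff {K : Type*} [Field K] [Fintype K] {a : K} (ha : a ≠ 0) :
    0 ∈ (Finset.univ.erase (0 : K)).image (fun x => a / x + x) ↔ IsSquare (-a) := by
  simp only [Finset.mem_image, Finset.mem_erase, Finset.mem_univ, and_true]
  constructor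
  · rintro ⟨x, hx, h⟩
    refine ⟨x, ?_⟩
    field_simp at h
    linear_combination -h
  · rintro ⟨x, h⟩
    have hx : x ≠ 0 := fun h0 => ha (by simpa [h0] using h)
    refine ⟨x, hx, ?_⟩
    field_simp
    linear_combination -h

theorem range_mul_pow_add {K : Type*} [Field K] [Fintype K] (hK : 2 < Fintype.card K) {c : K}
    (hc : c ≠ 0) :
    Set.range (fun x : K => (c * x) ^ (Fintype.card K - 2) + x) =
      (insert 0 ((Finset.univ.erase (0 : K)).image fun x => c⁻¹ / x + x) : Finset K) := by
  have hpow : ∀ x : K, x ≠ 0 → (c * x) ^ (Fintype.card K - 2) = c⁻¹ / x := fun x hx => by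
    have h := FiniteField.pow_card_sub_one_eq_one (c * x) (mul_ne_zero hc hx)
    rw [show Fintype.card K - 1 = Fintype.card K - 2 + 1 by omega, pow_succ] at h
    rw [eq_inv_of_mul_eq_one_left h, mul_inv, div_eq_mul_inv]
  have hzero : (0 : K) ^ (Fintype.card K - 2) = 0 := zero_pow (by omega)
  ext v
  simp only [Set.mem_range, Finset.coe_insert, Finset.coe_image, Set.mem_insert_iff,
    Set.mem_image, Finset.mem_coe, Finset.mem_erase, Finset.mem_univ, and_true]
  constructor
  · rintro ⟨x, rfl⟩
    by_cases hx : x = 0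
    · left
      simp [hx, hzero]
    · exact Or.inr ⟨x, hx, by rw [hpow x hx]⟩
  · rintro (rfl | ⟨x, hx, rfl⟩)
    · exact ⟨0, by simp [hzero]⟩
    · exact ⟨x, by rw [hpow x hx]⟩

/-- For odd `q > 2` and `c₀ ≠ 0`, the value set of `F(x) = (c₀ x)^{q-2} + x` over `F_q`
has exactly `(q + 1 + η(c₀) - η(-c₀))/2` elements. -/
theorem value_set_card_carlitz_rank_one
    (q : ℕ) (hq : 2 < q) (hodd : Odd q)
    (K : Type*) [Field K] [Fintype K] (hcard : Fintype.card K = q)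
    (c₀ : K) (hc₀ : c₀ ≠ 0) :
    (Set.ncard (Set.range (fun x : K => (c₀ * x) ^ (q - 2) + x)) : ℤ)
      = ((q : ℤ) + 1 + quadChar c₀ - quadChar (-c₀)) / 2 := by
  subst hcard
  have hK : ringChar K ≠ 2 := fun h =>
    Nat.not_even_iff_odd.2 hodd (Nat.even_iff.2 (FiniteField.even_card_iff_char_two.1 h))
  have ha : c₀⁻¹ ≠ 0 := inv_ne_zero hc₀
  have hcard := two_mul_card_image_div_add hK ha
  have hmem := zero_mem_image_div_add_iff ha
  rw [range_mul_pow_add hq hc₀, Set.ncard_coe_finset, ← quadChar_inv c₀, ← quadChar_inv (-c₀),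
    inv_neg, Finset.card_insert_eq_ite]
  have hneg : quadChar (-c₀⁻¹) = if IsSquare (-c₀⁻¹) then 1 else -1 := by
    rw [quadChar, if_neg (neg_ne_zero.2 ha)]
    congr
  rw [hneg]
  by_cases hsq : IsSquare (-c₀⁻¹)
  · rw [if_pos (hmem.2 hsq), if_pos hsq]
    omega
  · rw [if_neg (mt hmem.1 hsq), if_neg hsq]
    push_cast
    omega
end

section
/- Let q > 2 be a power of 2 and c_0 ∈ F_q with c_0 ≠ 0. Let F : F_q → F_q be given by F(x) = (c_0·x)^{q−2} + x. Then the value set V_F = {F(c) : c ∈ F_q} has cardinality #V_F = q/2. -/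
/-- A map on a finite type whose fibres are the orbits of a fixed-point-free involution has a range
of half the size of its domain. -/
theorem two_mul_ncard_range_of_fibers {α β : Type*} [Fintype α] (f : α → β) (σ : α → α)
    (hσ : ∀ x, σ x ≠ x) (hf : ∀ x y, f y = f x ↔ y = x ∨ y = σ x) :
    2 * (Set.range f).ncard = Fintype.card α := by
  classical
  have hrange : Set.range f = ((Finset.univ.image f : Finset β) : Set β) := by simp
  rw [hrange, Set.ncard_coe_finset, ← Finset.card_univ,
    Finset.card_eq_sum_card_image f Finset.univ, mul_comm, ← smul_eq_mul]
  refine (Finset.sum_const_nat fun b hb => ?_).symm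
  obtain ⟨x, -, rfl⟩ := Finset.mem_image.mp hb
  have hfiber : Finset.univ.filter (fun y => f y = f x) = {x, σ x} := by
    ext y
    simp [hf]
  rw [hfiber, Finset.card_pair (hσ x).symm]

theorem FiniteField.pow_card_sub_two {K : Type*} [Field K] [Fintype K]
    (hK : 2 < Fintype.card K) (x : K) : x ^ (Fintype.card K - 2) = x⁻¹ := by
  rcases eq_or_ne x 0 with rfl | hx
  · rw [zero_pow (by omega), inv_zero]
  · apply eq_inv_of_mul_eq_one_left
    rw [← pow_succ, ← FiniteField.pow_card_sub_one_eq_one x hx]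
    congr 1
    omega

/-- In characteristic two, the fibres of `x ↦ (c x)⁻¹ + x`, where `c s ^ 2 = 1`, are the orbits of
the involution that exchanges `0` and `s` and agrees with `x ↦ (c x)⁻¹` elsewhere. -/
theorem inv_mul_add_self_eq_iff {K : Type*} [Field K] [DecidableEq K] [CharP K 2] {c s : K}
    (hs : c * (s * s) = 1) (x y : K) :
    (c * y)⁻¹ + y = (c * x)⁻¹ + x ↔
      y = x ∨ y = if x = 0 then s else if x = s then 0 else (c * x)⁻¹ := by
  have hc : c ≠ 0 := left_ne_zero_of_mul_eq_one hs
  have hzero : ∀ z : K, (c * z)⁻¹ + z = 0 ↔ z = 0 ∨ z = s := by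
    intro z
    rcases eq_or_ne z 0 with rfl | hz
    · simp
    · rw [CharTwo.add_eq_zero, ← mul_eq_one_iff_inv_eq₀ (mul_ne_zero hc hz), mul_assoc,
        ← hs, mul_right_inj' hc, ← sq, ← sq, CharTwo.sq_inj]
      simp [hz]
  rcases eq_or_ne x 0 with rfl | hx
  · simpa using hzero y
  rcases eq_or_ne x s with rfl | hxs
  · rw [(hzero x).2 (Or.inr rfl), hzero y, if_neg hx, if_pos rfl, or_comm]
  rw [if_neg hx, if_neg hxs]
  rcases eq_or_ne y 0 with rfl | hy
  · have := hzero x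
    simp_all [eq_comm]
  have hfactor : (c * y)⁻¹ + y - ((c * x)⁻¹ + x) = (y - x) * (y - (c * x)⁻¹) * y⁻¹ := by
    field_simp
    ring
  rw [← sub_eq_zero, hfactor]
  simp [hy, sub_eq_zero]

/-- For `q > 2` a power of `2` and `c₀ ≠ 0`, the value set of `F(x) = (c₀ x)^{q-2} + x`
over `F_q` has exactly `q/2` elements. -/
theorem value_set_card_carlitz_rank_one_char_two
    (q : ℕ) (hq : 2 < q) (hq2 : ∃ m : ℕ, q = 2 ^ m)
    (K : Type*) [Field K] [Fintype K] (hcard : Fintype.card K = q)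
    (c₀ : K) (hc₀ : c₀ ≠ 0) :
    Set.ncard (Set.range (fun x : K => (c₀ * x) ^ (q - 2) + x)) = q / 2 := by
  classical
  subst hcard
  obtain ⟨m, hm⟩ := hq2
  have htwo : (2 : K) = 0 := by
    have h : ((2 ^ m : ℕ) : K) = 0 := by rw [← hm, Nat.cast_card_eq_zero]
    exact eq_zero_of_pow_eq_zero (by exact_mod_cast h)
  have : CharP K 2 := CharTwo.of_one_ne_zero_of_two_eq_zero one_ne_zero htwo
  obtain ⟨s, hs⟩ := FiniteField.isSquare_of_char_two (ringChar.eq K 2) c₀⁻¹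
  have hs' : c₀ * (s * s) = 1 := by rw [← hs, mul_inv_cancel₀ hc₀]
  simp only [FiniteField.pow_card_sub_two hq]
  have h := two_mul_ncard_range_of_fibers (fun x : K => (c₀ * x)⁻¹ + x)
    (fun x => if x = 0 then s else if x = s then 0 else (c₀ * x)⁻¹) ?_
    fun x y => inv_mul_add_self_eq_iff hs' x y
  · omega
  intro x
  have hs0 : s ≠ 0 := left_ne_zero_of_mul (right_ne_zero_of_mul_eq_one hs')
  split_ifs with hx hxs
  · rwa [hx]
  · exact Ne.symm hx
  · intro h
    have h' : c₀ * (x * x) = 1 := by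
      rw [← mul_assoc]
      nth_rw 2 [← h]
      exact mul_inv_cancel₀ (mul_ne_zero hc₀ hx)
    exact hxs (CharTwo.sq_inj.mp (by
      simpa only [sq] using mul_left_cancel₀ hc₀ (h'.trans hs'.symm)))
end

section
/- Let q > 2 be an odd prime power and c_1 ∈ F_q with c_1 ≠ 0, and suppose −3 ≠ 0 and 3 ≠ 0 in F_q (i.e., 4·(−1)+1 ≠ 0 and (−1)+4 ≠ 0). Let F : F_q → F_q be given by F(x) = ((−x)^{q−2} + c_1)^{q−2} + x (the case c_0 = −1). Then the value set V_F = {F(c) : c ∈ F_q} has cardinality #V_F = (q − η(−3))/2. -/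
open scoped Classical

/-- The map `z ↦ z + z⁻¹` is two-to-one away from `0`, `1` and `-1`. -/
theorem two_mul_card_image_add_inv {K : Type*} [Field K] [Fintype K] (h2 : (2 : K) ≠ 0) :
    2 * (((Finset.univ : Finset K) \ {0, 1, -1}).image (fun z => z + z⁻¹)).card + 3
      = Fintype.card K := by
  have h11 : (1 : K) ≠ -1 := fun h => h2 (by linear_combination h)
  have hcard : ((Finset.univ : Finset K) \ {0, 1, -1}).card + 3 = Fintype.card K := by
    have h : ({0, 1, -1} : Finset K).card = 3 :=
      Finset.card_eq_three.2 ⟨0, 1, -1, by simp, by simp, h11, rfl⟩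
    rw [← h, Finset.card_sdiff_add_card_eq_card (Finset.subset_univ _), Finset.card_univ]
  rw [← hcard, add_left_inj, mul_comm, eq_comm]
  refine (Finset.card_eq_sum_card_image (fun z : K => z + z⁻¹) _).trans
    (Finset.sum_const_nat fun b hb => ?_)
  obtain ⟨z, hz, rfl⟩ := Finset.mem_image.1 hb
  simp only [Finset.mem_sdiff, Finset.mem_univ, true_and, Finset.mem_insert,
    Finset.mem_singleton, not_or] at hz
  obtain ⟨h0, h1, hm1⟩ := hz
  refine Finset.card_eq_two.2 ⟨z, z⁻¹, ?_, ?_⟩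
  · intro h
    have hsq : (z - 1) * (z + 1) = 0 := by
      have := mul_inv_cancel₀ h0
      rw [← h] at this
      linear_combination this
    rcases mul_eq_zero.1 hsq with h | h
    · exact h1 (sub_eq_zero.1 h)
    · exact hm1 (eq_neg_of_add_eq_zero_left h)
  · ext w
    simp only [Finset.mem_filter, Finset.mem_sdiff, Finset.mem_univ, true_and, Finset.mem_insert,
      Finset.mem_singleton, not_or]
    constructor
    · rintro ⟨⟨hw, -, -⟩, h⟩
      have hprod : (w - z) * (w - z⁻¹) = 0 := by
        linear_combination w * h - mul_inv_cancel₀ hw + mul_inv_cancel₀ h0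
      rcases mul_eq_zero.1 hprod with h | h
      · exact Or.inl (sub_eq_zero.1 h)
      · exact Or.inr (sub_eq_zero.1 h)
    · rintro (rfl | rfl)
      · exact ⟨⟨h0, h1, hm1⟩, rfl⟩
      · refine ⟨⟨inv_ne_zero h0, by simpa using h1, ?_⟩, by rw [inv_inv, add_comm]⟩
        intro h
        exact hm1 (by rw [← inv_inv z, h, inv_neg, inv_one])

theorem exists_add_inv_eq_neg_one_iff {K : Type*} [Field K] (h2 : (2 : K) ≠ 0) :
    (∃ z : K, z ≠ 0 ∧ z + z⁻¹ = -1) ↔ IsSquare (-3 : K) := by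
  constructor
  · rintro ⟨z, h0, h⟩
    exact ⟨2 * z + 1, by linear_combination -4 * z * h + 4 * mul_inv_cancel₀ h0⟩
  · rintro ⟨s, hs⟩
    have hz : ((s - 1) / 2) * ((s - 1) / 2) + (s - 1) / 2 + 1 = 0 := by
      field_simp
      linear_combination -hs
    have h0 : (s - 1) / 2 ≠ 0 := by
      intro h
      simp [h] at hz
    refine ⟨(s - 1) / 2, h0, ?_⟩
    apply mul_left_cancel₀ h0
    linear_combination hz + mul_inv_cancel₀ h0

theorem range_inv_add_inv_add {K : Type*} [Field K] [Fintype K] (h2 : (2 : K) ≠ 0)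
    {c : K} (hc : c ≠ 0) :
    Set.range (fun x : K => ((-x)⁻¹ + c)⁻¹ + x)
      = (fun u : K => (u + 2) * c⁻¹) '' (insert (-1) (insert 2
        (((Finset.univ : Finset K) \ {0, 1, -1}).image (fun z => z + z⁻¹))) : Finset K) := by
  have key : ∀ z : K, z ≠ 0 → z ≠ -1 →
      ((-((z + 1) * c⁻¹))⁻¹ + c)⁻¹ + (z + 1) * c⁻¹ = (z + z⁻¹ + 2) * c⁻¹ := by
    intro z h0 h1
    have h1' : z + 1 ≠ 0 := fun h => h1 (eq_neg_of_add_eq_zero_left h)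
    have h : (-((z + 1) * c⁻¹))⁻¹ + c = c * z / (z + 1) := by
      field_simp
      ring
    rw [h]
    field_simp
    ring
  ext y
  simp only [Set.mem_range, Set.mem_image, Finset.coe_insert, Set.mem_insert_iff, Finset.mem_coe,
    Finset.mem_image, Finset.mem_sdiff, Finset.mem_univ, true_and, Finset.mem_insert,
    Finset.mem_singleton, not_or]
  constructor
  · rintro ⟨x, rfl⟩
    obtain ⟨z, rfl⟩ : ∃ z, x = (z + 1) * c⁻¹ := ⟨x * c - 1, by field_simp; ring⟩
    by_cases h0 : z = 0
    · exact ⟨-1, Or.inl rfl, by subst h0; simp; ring⟩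
    by_cases hm1 : z = -1
    · exact ⟨-1, Or.inl rfl, by subst hm1; simp; ring⟩
    refine ⟨z + z⁻¹, ?_, (key z h0 hm1).symm⟩
    by_cases h1 : z = 1
    · exact Or.inr (Or.inl (by subst h1; rw [inv_one]; norm_num))
    · exact Or.inr (Or.inr ⟨z, ⟨h0, h1, hm1⟩, rfl⟩)
  · rintro ⟨u, rfl | rfl | ⟨z, ⟨h0, -, hm1⟩, rfl⟩, rfl⟩
    · exact ⟨0, by simp; ring⟩
    · refine ⟨(1 + 1) * c⁻¹, ?_⟩
      rw [key 1 one_ne_zero fun h => h2 (by linear_combination h), inv_one]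
      ring
    · exact ⟨(z + 1) * c⁻¹, key z h0 hm1⟩

/-- For odd `q > 2`, `c₁ ≠ 0`, and `±3 ≠ 0` in `F_q`, the value set of
`F(x) = ((-x)^{q-2} + c₁)^{q-2} + x` (the case `c₀ = -1`) over `F_q` has exactly
`(q - η(-3))/2` elements. -/
theorem value_set_card_carlitz_rank_two_c0_eq_neg_one
    (q : ℕ) (hq : 2 < q) (hodd : Odd q)
    (K : Type*) [Field K] [Fintype K] (hcard : Fintype.card K = q)
    (c₁ : K) (hc₁ : c₁ ≠ 0)
    (h3 : (-3 : K) ≠ 0) (h3' : (3 : K) ≠ 0) :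
    (Set.ncard (Set.range (fun x : K => ((-x) ^ (q - 2) + c₁) ^ (q - 2) + x)) : ℤ)
      = ((q : ℤ) - quadChar (-3 : K)) / 2 := by
  have h2 : (2 : K) ≠ 0 := by
    apply Ring.two_ne_zero
    intro h
    have := FiniteField.even_card_of_char_two h
    have := Nat.odd_iff.1 hodd
    omega
  have hinv : ∀ x : K, x ^ (q - 2) = x⁻¹ := by
    intro x
    by_cases hx : x = 0
    · rw [hx, inv_zero, zero_pow (by omega)]
    · apply eq_inv_of_mul_eq_one_left
      rw [← pow_succ, show q - 2 + 1 = q - 1 by omega, ← hcard]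
      exact FiniteField.pow_card_sub_one_eq_one x hx
  have hinj : Function.Injective (fun u : K => (u + 2) * c₁⁻¹) := fun a b h =>
    add_right_cancel (mul_right_cancel₀ (inv_ne_zero hc₁) h)
  simp only [hinv]
  rw [range_inv_add_inv_add h2 hc₁, Set.ncard_image_of_injective _ hinj, Set.ncard_coe_finset]
  have hT := two_mul_card_image_add_inv (K := K) h2
  rw [hcard] at hT
  set T := ((Finset.univ : Finset K) \ {0, 1, -1}).image (fun z => z + z⁻¹) with hTdef
  have h2T : (2 : K) ∉ T := by
    simp only [hTdef, Finset.mem_image, Finset.mem_sdiff, Finset.mem_univ, true_and,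
      Finset.mem_insert, Finset.mem_singleton, not_or]
    rintro ⟨z, ⟨h0, h1, -⟩, h⟩
    have hz : (z - 1) ^ 2 = 0 := by linear_combination z * h - mul_inv_cancel₀ h0
    exact h1 (sub_eq_zero.1 (pow_eq_zero_iff two_ne_zero |>.1 hz))
  have hm1T : (-1 : K) ∈ insert 2 T ↔ IsSquare (-3 : K) := by
    rw [← exists_add_inv_eq_neg_one_iff h2]
    simp only [hTdef, Finset.mem_image, Finset.mem_sdiff, Finset.mem_univ, true_and,
      Finset.mem_insert, Finset.mem_singleton, not_or]
    constructor
    · rintro (h | ⟨z, ⟨h0, -, -⟩, h⟩)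
      · exact absurd (by linear_combination -h) h3'
      · exact ⟨z, h0, h⟩
    · rintro ⟨z, h0, h⟩
      refine Or.inr ⟨z, ⟨h0, ?_, ?_⟩, h⟩
      · rintro rfl
        rw [inv_one] at h
        exact h3' (by linear_combination h)
      · rintro rfl
        rw [inv_neg, inv_one] at h
        exact one_ne_zero (α := K) (by linear_combination -h)
  rw [quadChar, if_neg h3]
  have hcard2 := Finset.card_insert_of_notMem h2T
  by_cases hs : IsSquare (-3 : K)
  · rw [if_pos hs, Finset.insert_eq_of_mem (hm1T.2 hs)]
    omega
  · rw [if_neg hs, Finset.card_insert_of_notMem (mt hm1T.1 hs)]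
    omega
end

section
/- Let q be an odd prime power and α, β, γ, δ ∈ F_q with γ ≠ 0 and α·δ − β·γ ≠ 0. Then the image of the set {x ∈ F_q : γ·x + δ ≠ 0} under the map x ↦ (α·x + β)/(γ·x + δ) + x has at most (q + 1)/2 elements. -/
/-- If `f` is invariant under a map `σ` of `s` into itself, then twice the size
of the image of `f` is at most the size of `s` plus the number of fixed points of `σ`. -/
theorem Finset.two_mul_card_image_le_of_comp_eq {ι κ : Type*} [DecidableEq ι] [DecidableEq κ]
    (s : Finset ι) (f : ι → κ) (σ : ι → ι) (hσ : ∀ x ∈ s, σ x ∈ s)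
    (hf : ∀ x ∈ s, f (σ x) = f x) :
    2 * (s.image f).card ≤ s.card + (s.filter fun x => σ x = x).card := by
  have h_fixed : ∀ x ∈ s.filter (fun x => σ x = x), f x ∈ s.image f := fun x hx =>
    mem_image_of_mem f (mem_filter.1 hx).1
  rw [card_eq_sum_card_image f s, card_eq_sum_card_fiberwise h_fixed, ← sum_add_distrib, mul_comm,
    ← smul_eq_mul]
  refine card_nsmul_le_sum _ _ _ fun y hy => ?_
  obtain ⟨x, hx, rfl⟩ := mem_image.1 hy
  by_cases h : σ x = x
  · have h₁ : 0 < (s.filter fun z => f z = f x).card := card_pos.2 ⟨x, by simp [hx]⟩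
    have h₂ : 0 < ((s.filter fun z => σ z = z).filter fun z => f z = f x).card :=
      card_pos.2 ⟨x, by simp [hx, h]⟩
    omega
  · have h_sub : {x, σ x} ⊆ s.filter fun z => f z = f x := by
      simp [insert_subset_iff, hx, hσ x hx, hf x hx]
    have h_card := card_le_card h_sub
    rw [card_pair (Ne.symm h)] at h_card
    omega

/-- A set of points at which an injective function takes values with a common square has at most
two elements. -/
theorem Finset.card_le_two_of_sq_eq {ι R : Type*} [CommRing R] [NoZeroDivisors R]
    (s : Finset ι) (g : ι → R) (hg : Function.Injective g) (c : R) (hs : ∀ x ∈ s, g x ^ 2 = c) :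
    s.card ≤ 2 := by
  classical
  rcases s.eq_empty_or_nonempty with rfl | ⟨a, ha⟩
  · simp
  rw [← card_image_of_injective s hg]
  refine (card_le_card (t := {g a, -g a}) fun y hy => ?_).trans card_le_two
  obtain ⟨x, hx, rfl⟩ := mem_image.1 hy
  simpa using sq_eq_sq_iff_eq_or_eq_neg.1 ((hs x hx).trans (hs a ha).symm)

/-- For odd `q` and `α, β, γ, δ ∈ F_q` with `γ ≠ 0` and `αδ - βγ ≠ 0`, the image of
`{x : γx + δ ≠ 0}` under `x ↦ (αx + β)/(γx + δ) + x` has at most `(q+1)/2` elements. -/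
theorem image_card_fractional_linear_plus_x_odd
    (q : ℕ) (hodd : Odd q)
    (K : Type*) [Field K] [Fintype K] (hcard : Fintype.card K = q)
    (α β γ δ : K) (hγ : γ ≠ 0) (hdet : α * δ - β * γ ≠ 0) :
    Set.ncard ((fun x : K => (α * x + β) / (γ * x + δ) + x) ''
        {x : K | γ * x + δ ≠ 0}) ≤ (q + 1) / 2 := by
  classical
  set s : Finset K := Finset.univ.filter fun x => γ * x + δ ≠ 0 with hs
  set f : K → K := fun x => (α * x + β) / (γ * x + δ) + x
  set σ : K → K := fun x => (-(α * δ - β * γ) / (γ * x + δ) - δ) / γ with hσ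
  have hσ_den : ∀ x, γ * σ x + δ = -(α * δ - β * γ) / (γ * x + δ) := fun x => by
    simp only [hσ]
    rw [mul_div_cancel₀ _ hγ, sub_add_cancel]
  have hf_eq : ∀ x, γ * x + δ ≠ 0 →
      f x = (α - δ + (γ * x + δ) + -(α * δ - β * γ) / (γ * x + δ)) / γ := fun x hx => by
    simp only [f]
    rw [div_add' _ _ _ hx, add_div' _ _ _ hx, div_div, div_eq_div_iff hx (mul_ne_zero hx hγ)]
    ring
  have hσ_ne : ∀ x, γ * x + δ ≠ 0 → γ * σ x + δ ≠ 0 := fun x hx => by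
    rw [hσ_den]
    exact div_ne_zero (neg_ne_zero.2 hdet) hx
  have h_image := Finset.two_mul_card_image_le_of_comp_eq s f σ
    (fun x hx => by simpa [hs] using hσ_ne x (by simpa [hs] using hx))
    (fun x hx => by
      have hx : γ * x + δ ≠ 0 := by simpa [hs] using hx
      rw [hf_eq _ (hσ_ne x hx), hf_eq x hx, hσ_den, div_div_cancel₀ (neg_ne_zero.2 hdet)]
      ring)
  have h_fixed : (s.filter fun x => σ x = x).card ≤ 2 := by
    refine Finset.card_le_two_of_sq_eq _ (fun x => γ * x + δ)
      (fun x y h => mul_left_cancel₀ hγ (add_right_cancel h)) (-(α * δ - β * γ)) fun x hx => ?_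
    simp only [hs, Finset.mem_filter, Finset.mem_univ, true_and] at hx
    have h := hσ_den x
    rw [hx.2, eq_div_iff hx.1] at h
    rw [sq, h]
  have h_domain : s.card < q := by
    rw [← hcard]
    refine Finset.card_lt_univ_of_notMem (x := -δ / γ) ?_
    simp [hs, mul_div_cancel₀ _ hγ]
  have h_coe : f '' {x : K | γ * x + δ ≠ 0} = (s.image f : Finset K) := by simp [hs]
  rw [h_coe, Set.ncard_coe_finset]
  omega
end

section
/- Let p be a prime, r ≥ 1 an integer, and a ∈ F_{p^r} with a ≠ 0 and a^{(p^r − 1)/(p − 1)} ≠ (−1)^r. Then the map x ↦ a·x^p is a complete mapping of F_{p^r}, i.e., both x ↦ a·x^p and x ↦ a·x^p + x are bijections of F_{p^r}. -/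
theorem neg_one_pow_geomSum_char {R : Type*} [CommRing R] (p : ℕ) [Fact p.Prime] [CharP R p]
    (r : ℕ) : (-1 : R) ^ (∑ i ∈ Finset.range r, p ^ i) = (-1) ^ r := by
  rw [← Finset.prod_pow_eq_pow_sum]
  simp only [neg_one_pow_char_pow R p, Finset.prod_const, Finset.card_range]

/-- For a prime `p`, `r ≥ 1`, and `a ∈ F_{p^r}` with `a ≠ 0` and
`a^{(p^r-1)/(p-1)} ≠ (-1)^r`, the map `x ↦ a x^p` is a complete mapping of `F_{p^r}`. -/
theorem complete_mapping_a_mul_x_pow_p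
    (p : ℕ) (hp : p.Prime) (r : ℕ) (hr : 1 ≤ r)
    (K : Type*) [Field K] [Fintype K] (hcard : Fintype.card K = p ^ r)
    (a : K) (ha : a ≠ 0) (hnorm : a ^ ((p ^ r - 1) / (p - 1)) ≠ (-1 : K) ^ r) :
    Function.Bijective (fun x : K => a * x ^ p) ∧
      Function.Bijective (fun x : K => a * x ^ p + x) := by
  have : Fact p.Prime := ⟨hp⟩
  have : CharP K p := charP_of_card_eq_prime_pow hcard
  rw [← Finite.injective_iff_bijective, ← Finite.injective_iff_bijective]
  refine ⟨fun x y h => frobenius_inj K p (mul_left_cancel₀ ha h), fun x y h => ?_⟩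
  by_contra hxy
  have hz : x - y ≠ 0 := sub_ne_zero.mpr hxy
  have hker : a * (x - y) ^ p = -(x - y) := by
    rw [sub_pow_char]
    linear_combination h
  have hroot : a * (x - y) ^ (p - 1) = -1 := by
    apply mul_right_cancel₀ hz
    rw [mul_assoc, ← pow_succ, Nat.sub_add_cancel hp.one_le, hker, neg_one_mul]
  have hdvd : (p - 1) * ((p ^ r - 1) / (p - 1)) = p ^ r - 1 :=
    Nat.mul_div_cancel' (by simpa using Nat.sub_dvd_pow_sub_pow p 1 r)
  have hpow := congrArg (· ^ ((p ^ r - 1) / (p - 1))) hroot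
  simp only [mul_pow] at hpow
  rw [← pow_mul, hdvd, ← hcard, FiniteField.pow_card_sub_one_eq_one _ hz, mul_one, hcard] at hpow
  apply hnorm
  rw [hpow, ← Nat.geomSum_eq hp.two_le, neg_one_pow_geomSum_char]
end

section
/- Let F_8 = F_2(γ), where γ is a root of the polynomial x³ + x + 1 (irreducible over F_2). Then the map f : F_8 → F_8 given by f(x) = γ·(x⁴ + 1) + γ^{−1}·(x² + x) is a complete mapping of F_8, and it satisfies f(c) = ((((γ·c)⁶ + 1)⁶ + γ^{−3})⁶ + 1)⁶ for all c ∈ F_8; consequently its Carlitz rank equals 4 = ⌊8/2⌋. -/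
/-- The map `P_n(a_0, a_1, …, a_{n+1}; x) = (…((a_0 x + a_1)^{q-2} + a_2)^{q-2} … + a_n)^{q-2} + a_{n+1}`. -/
def Pnth {K : Type*} [Field K] (q : ℕ) (n : ℕ) (a : ℕ → K) (x : K) : K :=
  Nat.rec (motive := fun _ => K) (a 0 * x + a 1)
    (fun k acc => acc ^ (q - 2) + a (k + 2)) n

/-- The Carlitz rank of `f : K → K` (with `#K = q`). -/
noncomputable def carlitzRank {K : Type*} [Field K] (q : ℕ) (f : K → K) : ℕ :=
  sInf {n : ℕ | ∃ a : ℕ → K, a 0 ≠ 0 ∧ (∀ i, 2 ≤ i → i ≤ n → a i ≠ 0) ∧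
    ∀ x, f x = Pnth q n a x}

/-- Coordinates of an element of `F_8 = F_2(γ)` in the basis `1, γ, γ²`. -/
abbrev F8Coord : Type := ZMod 2 × ZMod 2 × ZMod 2

namespace F8Coord

/-- Multiplication in coordinates, reduced by `γ³ = γ + 1`. -/
def mul (x y : F8Coord) : F8Coord :=
  (x.1 * y.1 + (x.2.1 * y.2.2 + x.2.2 * y.2.1),
    x.1 * y.2.1 + x.2.1 * y.1 + (x.2.1 * y.2.2 + x.2.2 * y.2.1) + x.2.2 * y.2.2,
    x.1 * y.2.2 + x.2.1 * y.2.1 + x.2.2 * y.1 + x.2.2 * y.2.2)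

/-- Squaring in coordinates. -/
def sq (x : F8Coord) : F8Coord := mul x x

/-- The map `x ↦ x⁶`, that is, inversion extended by `0 ↦ 0`, in coordinates. -/
def pow6 (x : F8Coord) : F8Coord := mul (sq (sq x)) (sq x)

/-- The map `x ↦ γ(x⁴ + 1) + γ⁻¹(x² + x)` in coordinates, where `γ⁻¹ = 1 + γ²`. -/
def exampleMap (x : F8Coord) : F8Coord :=
  mul (0, 1, 0) (sq (sq x) + (1, 0, 0)) + mul (1, 0, 1) (sq x + x)

/-- The map `h` is affine: its constant term and slope are read off at `0` and `1`. -/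
def IsAffine (h : F8Coord → F8Coord) : Prop :=
  ∀ x, h x = mul (h 0 + h (1, 0, 0)) x + h 0

instance (h : F8Coord → F8Coord) : Decidable (IsAffine h) :=
  inferInstanceAs (Decidable (∀ x, h x = mul (h 0 + h (1, 0, 0)) x + h 0))

lemma pow6_pow6 : ∀ x, pow6 (pow6 x) = x := by decide +kernel

lemma add_add_cancel_self : ∀ x y : F8Coord, x + y + y = x := by decide +kernel

lemma isAffine_mul_add : ∀ a b : F8Coord, IsAffine fun x => mul a x + b := by decide +kernel

lemma exampleMap_injective : Function.Injective exampleMap := by decide +kernel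

lemma exampleMap_add_id_injective : Function.Injective fun x => exampleMap x + x := by
  decide +kernel

lemma exampleMap_eq_pow6 : ∀ x, exampleMap x =
    pow6 (pow6 (pow6 (pow6 (mul (0, 1, 0) x) + (1, 0, 0)) +
      mul (sq (1, 0, 1)) (1, 0, 1)) + (1, 0, 0)) := by
  decide +kernel

lemma not_isAffine_two_inversions : ∀ b c : F8Coord,
    ¬ IsAffine fun x => pow6 (pow6 (exampleMap x + c) + b) := by
  decide +kernel

lemma not_isAffine_three_inversions : ∀ b c d : F8Coord,
    ¬ IsAffine fun x => pow6 (pow6 (pow6 (exampleMap x + d) + c) + b) := by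
  decide +kernel

lemma exampleMap_ne_two_inversions (a₀ a₁ a₂ a₃ : F8Coord) :
    ¬ ∀ x, exampleMap x = pow6 (pow6 (mul a₀ x + a₁) + a₂) + a₃ := by
  intro h
  apply not_isAffine_two_inversions a₂ a₃
  simpa only [h, add_add_cancel_self, pow6_pow6] using isAffine_mul_add a₀ a₁

lemma exampleMap_ne_three_inversions (a₀ a₁ a₂ a₃ a₄ : F8Coord) :
    ¬ ∀ x, exampleMap x = pow6 (pow6 (pow6 (mul a₀ x + a₁) + a₂) + a₃) + a₄ := by
  intro h
  apply not_isAffine_three_inversions a₂ a₃ a₄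
  simpa only [h, add_add_cancel_self, pow6_pow6] using isAffine_mul_add a₀ a₁

section Eval

variable {K : Type*} [Field K] [CharP K 2]

/-- The element `x₀ + x₁ γ + x₂ γ²` with coordinates `x`. -/
def eval (γ : K) (x : F8Coord) : K :=
  ZMod.castHom (dvd_refl 2) K x.1 + ZMod.castHom (dvd_refl 2) K x.2.1 * γ +
    ZMod.castHom (dvd_refl 2) K x.2.2 * γ ^ 2

lemma eval_add (γ : K) (x y : F8Coord) : eval γ (x + y) = eval γ x + eval γ y := by
  simp only [eval, Prod.fst_add, Prod.snd_add, map_add]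
  ring

lemma eval_one (γ : K) : eval γ (1, 0, 0) = 1 := by simp [eval]

lemma eval_root (γ : K) : eval γ (0, 1, 0) = γ := by simp [eval]

variable {γ : K}

lemma root_pow_three (hγ : γ ^ 3 + γ + 1 = 0) : γ ^ 3 = γ + 1 := by
  linear_combination hγ - (γ + 1) * CharTwo.two_eq_zero (R := K)

lemma eval_mul (hγ : γ ^ 3 + γ + 1 = 0) (x y : F8Coord) : eval γ (mul x y) = eval γ x * eval γ y := by
  simp only [eval, mul, map_add, map_mul]
  generalize ZMod.castHom (dvd_refl 2) K x.1 = a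
  generalize ZMod.castHom (dvd_refl 2) K x.2.1 = b
  generalize ZMod.castHom (dvd_refl 2) K x.2.2 = c
  generalize ZMod.castHom (dvd_refl 2) K y.1 = a'
  generalize ZMod.castHom (dvd_refl 2) K y.2.1 = b'
  generalize ZMod.castHom (dvd_refl 2) K y.2.2 = c'
  linear_combination -(b * c' + c * b' + c * c' * γ) * root_pow_three hγ

lemma eval_sq (hγ : γ ^ 3 + γ + 1 = 0) (x : F8Coord) : eval γ (sq x) = eval γ x ^ 2 := by
  rw [sq, eval_mul hγ, pow_two]

lemma eval_pow6 (hγ : γ ^ 3 + γ + 1 = 0) (x : F8Coord) : eval γ (pow6 x) = eval γ x ^ 6 := by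
  rw [pow6, eval_mul hγ, eval_sq hγ, eval_sq hγ]
  ring

lemma eval_inv_root (hγ : γ ^ 3 + γ + 1 = 0) : eval γ (1, 0, 1) = γ⁻¹ := by
  apply eq_inv_of_mul_eq_one_left
  simp only [eval, map_one, map_zero]
  linear_combination root_pow_three hγ + γ * CharTwo.two_eq_zero (R := K)

lemma eval_exampleMap (hγ : γ ^ 3 + γ + 1 = 0) (x : F8Coord) :
    eval γ (exampleMap x) =
      γ * (eval γ x ^ 4 + 1) + γ⁻¹ * (eval γ x ^ 2 + eval γ x) := by
  simp only [exampleMap, eval_add, eval_mul hγ, eval_sq hγ, eval_one, eval_root,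
    eval_inv_root hγ]
  ring

lemma eval_injective (hγ : γ ^ 3 + γ + 1 = 0) : Function.Injective (eval γ) := by
  have mul_pow6 : ∀ z : F8Coord, z ≠ 0 → mul z (pow6 z) = (1, 0, 0) := by decide +kernel
  have add_eq_zero : ∀ x y : F8Coord, x + y = 0 → x = y := by decide +kernel
  intro x y hxy
  apply add_eq_zero
  by_contra hz
  have h := congrArg (eval γ) (mul_pow6 _ hz)
  rw [eval_mul hγ, eval_add, hxy, CharTwo.add_self_eq_zero, zero_mul, eval_one] at h
  exact zero_ne_one h

lemma eval_bijective (hγ : γ ^ 3 + γ + 1 = 0) [Fintype K]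
    (hcard : Fintype.card K = 8) : Function.Bijective (eval γ) :=
  (Fintype.bijective_iff_injective_and_card _).2 ⟨eval_injective hγ, by
    rw [hcard]; simp [ZMod.card]⟩

end Eval

end F8Coord

lemma charP_two_of_card_eq_eight {K : Type*} [Field K] [Fintype K]
    (hcard : Fintype.card K = 8) : CharP K 2 := by
  have h : ((8 : ℕ) : K) = 0 := hcard ▸ Nat.cast_card_eq_zero K
  refine CharTwo.of_one_ne_zero_of_two_eq_zero one_ne_zero ?_
  exact pow_eq_zero_iff (n := 3) (by norm_num) |>.1 (by norm_num at h ⊢; exact h)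

/-- In `F_8 = F_2(γ)` with `γ³ + γ + 1 = 0`, the map
`f(x) = γ(x⁴ + 1) + γ⁻¹(x² + x)` is a complete mapping, it satisfies
`f(c) = ((((γc)⁶ + 1)⁶ + γ⁻³)⁶ + 1)⁶`, and its Carlitz rank equals `4 = ⌊8/2⌋`. -/
theorem complete_mapping_example_F8
    (K : Type*) [Field K] [Fintype K] (hcard : Fintype.card K = 8)
    (γ : K) (hγ : γ ^ 3 + γ + 1 = 0)
    (f : K → K) (hf : ∀ x, f x = γ * (x ^ 4 + 1) + γ⁻¹ * (x ^ 2 + x)) :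
    (Function.Bijective f ∧ Function.Bijective (fun x => f x + x)) ∧
      (∀ c : K, f c = ((((γ * c) ^ 6 + 1) ^ 6 + γ⁻¹ ^ 3) ^ 6 + 1) ^ 6) ∧
      carlitzRank 8 f = 4 := by
  have := charP_two_of_card_eq_eight hcard
  obtain ⟨hinj, hsurj⟩ := F8Coord.eval_bijective hγ hcard
  have hf_eval : ∀ x, f (F8Coord.eval γ x) = F8Coord.eval γ (F8Coord.exampleMap x) := fun x => by
    rw [hf, F8Coord.eval_exampleMap hγ]
  have hformula : ∀ c : K, f c = ((((γ * c) ^ 6 + 1) ^ 6 + γ⁻¹ ^ 3) ^ 6 + 1) ^ 6 := by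
    intro c
    obtain ⟨x, rfl⟩ := hsurj c
    rw [hf_eval, F8Coord.exampleMap_eq_pow6]
    simp only [F8Coord.eval_pow6 hγ, F8Coord.eval_add, F8Coord.eval_mul hγ, F8Coord.eval_sq hγ,
      F8Coord.eval_one, F8Coord.eval_root, F8Coord.eval_inv_root hγ, ← pow_succ]
  have hγ0 : γ ≠ 0 := by
    rintro rfl
    simp at hγ
  refine ⟨⟨Finite.injective_iff_bijective.1 ?_, Finite.injective_iff_bijective.1 ?_⟩,
    hformula, ?_⟩
  · intro c d h
    obtain ⟨x, rfl⟩ := hsurj c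
    obtain ⟨y, rfl⟩ := hsurj d
    rw [hf_eval, hf_eval] at h
    rw [F8Coord.exampleMap_injective (hinj h)]
  · intro c d h
    obtain ⟨x, rfl⟩ := hsurj c
    obtain ⟨y, rfl⟩ := hsurj d
    simp only [hf_eval, ← F8Coord.eval_add] at h
    rw [F8Coord.exampleMap_add_id_injective (hinj h)]
  · have htwo : ∀ a₀ a₁ a₂ a₃ : K, ¬ ∀ x, f x = ((a₀ * x + a₁) ^ 6 + a₂) ^ 6 + a₃ := by
      intro a₀ a₁ a₂ a₃ h
      obtain ⟨b₀, rfl⟩ := hsurj a₀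
      obtain ⟨b₁, rfl⟩ := hsurj a₁
      obtain ⟨b₂, rfl⟩ := hsurj a₂
      obtain ⟨b₃, rfl⟩ := hsurj a₃
      refine F8Coord.exampleMap_ne_two_inversions b₀ b₁ b₂ b₃ fun x => hinj ?_
      rw [← hf_eval, h]
      simp only [F8Coord.eval_pow6 hγ, F8Coord.eval_add, F8Coord.eval_mul hγ]
    have hthree : ∀ a₀ a₁ a₂ a₃ a₄ : K,
        ¬ ∀ x, f x = (((a₀ * x + a₁) ^ 6 + a₂) ^ 6 + a₃) ^ 6 + a₄ := by
      intro a₀ a₁ a₂ a₃ a₄ h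
      obtain ⟨b₀, rfl⟩ := hsurj a₀
      obtain ⟨b₁, rfl⟩ := hsurj a₁
      obtain ⟨b₂, rfl⟩ := hsurj a₂
      obtain ⟨b₃, rfl⟩ := hsurj a₃
      obtain ⟨b₄, rfl⟩ := hsurj a₄
      refine F8Coord.exampleMap_ne_three_inversions b₀ b₁ b₂ b₃ b₄ fun x => hinj ?_
      rw [← hf_eval, h]
      simp only [F8Coord.eval_pow6 hγ, F8Coord.eval_add, F8Coord.eval_mul hγ]
    have hinv : ∀ c : K, (c ^ 6) ^ 6 = c := by
      intro c
      obtain ⟨x, rfl⟩ := hsurj c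
      rw [← F8Coord.eval_pow6 hγ, ← F8Coord.eval_pow6 hγ, F8Coord.pow6_pow6]
    refine IsLeast.csInf_eq ⟨⟨fun i => if i = 0 then γ else if i = 1 then 0 else
      if i = 3 then γ⁻¹ ^ 3 else if i = 5 then 0 else 1, ?_, ?_, ?_⟩, ?_⟩
    · simpa using hγ0
    · intro i hi hi'
      interval_cases i <;> simp [hγ0]
    · intro x
      rw [hformula]
      change _ = ((((γ * x + 0) ^ 6 + 1) ^ 6 + γ⁻¹ ^ 3) ^ 6 + 1) ^ 6 + 0
      simp only [add_zero]
    · rintro n ⟨a, -, -, h⟩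
      by_contra! hn
      interval_cases n
      · exact htwo (a 0) (a 1) 0 0 fun x => by simpa [Pnth, hinv] using h x
      · exact hthree (a 0) (a 1) 0 0 (a 2) fun x => by simpa [Pnth, hinv] using h x
      · exact htwo (a 0) (a 1) (a 2) (a 3) h
      · exact hthree (a 0) (a 1) (a 2) (a 3) (a 4) h
end

section
/- The map f : F_7 → F_7 given by f(x) = x⁴ − x³ + 3·x² − x + 1 is a complete mapping of F_7, and it satisfies f(c) = ((c⁵ + 3)⁵ + 3)⁵ for all c ∈ F_7; consequently its Carlitz rank equals 3 = ⌊7/2⌋. -/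
instance : Fact (Nat.Prime 7) := ⟨by norm_num⟩

theorem F7_quartic_ne_affine (a b : ZMod 7) :
    ∃ x : ZMod 7, x ^ 4 - x ^ 3 + 3 * x ^ 2 - x + 1 ≠ a * x + b := by
  revert a b
  decide

theorem F7_quartic_ne_one_inversion (a b c : ZMod 7) (ha : a ≠ 0) :
    ∃ x : ZMod 7, x ^ 4 - x ^ 3 + 3 * x ^ 2 - x + 1 ≠ (a * x + b) ^ 5 + c := by
  revert a b c
  decide +kernel

theorem F7_quartic_ne_two_inversions (a b c d : ZMod 7) (ha : a ≠ 0) (hc : c ≠ 0) :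
    ∃ x : ZMod 7, x ^ 4 - x ^ 3 + 3 * x ^ 2 - x + 1 ≠ ((a * x + b) ^ 5 + c) ^ 5 + d := by
  revert a b c d
  decide +kernel

/-- `f(x) = x⁴ - x³ + 3x² - x + 1` is a complete mapping of `F_7`, it satisfies
`f(c) = ((c⁵ + 3)⁵ + 3)⁵`, and its Carlitz rank equals `3 = ⌊7/2⌋`. -/
theorem complete_mapping_example_F7
    (f : ZMod 7 → ZMod 7)
    (hf : ∀ x, f x = x ^ 4 - x ^ 3 + 3 * x ^ 2 - x + 1) :
    (Function.Bijective f ∧ Function.Bijective (fun x => f x + x)) ∧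
      (∀ c : ZMod 7, f c = ((c ^ 5 + 3) ^ 5 + 3) ^ 5) ∧
      carlitzRank 7 f = 3 := by
  obtain rfl : f = fun x => x ^ 4 - x ^ 3 + 3 * x ^ 2 - x + 1 := funext hf
  have hcomp : ∀ c : ZMod 7,
      c ^ 4 - c ^ 3 + 3 * c ^ 2 - c + 1 = ((c ^ 5 + 3) ^ 5 + 3) ^ 5 := by decide +kernel
  refine ⟨⟨Finite.injective_iff_bijective.1 ?_, Finite.injective_iff_bijective.1 ?_⟩, hcomp, ?_⟩
  · unfold Function.Injective
    decide +kernel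
  · unfold Function.Injective
    decide +kernel
  · refine IsLeast.csInf_eq ⟨⟨fun i => if i = 0 then 1 else if i = 2 ∨ i = 3 then 3 else 0,
      by simp, fun i h2 h3 => ?_, fun x => ?_⟩, ?_⟩
    · have : i = 2 ∨ i = 3 := by omega
      simp only [this, if_true, show i ≠ 0 by omega, if_false]
      decide
    · change _ = (((1 * x + 0) ^ 5 + 3) ^ 5 + 3) ^ 5 + 0
      simpa using hcomp x
    · rintro n ⟨a, ha, hne, h⟩
      by_contra! hn
      interval_cases n
      · obtain ⟨x, hx⟩ := F7_quartic_ne_affine (a 0) (a 1)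
        exact hx (h x)
      · obtain ⟨x, hx⟩ := F7_quartic_ne_one_inversion (a 0) (a 1) (a 2) ha
        exact hx (h x)
      · obtain ⟨x, hx⟩ := F7_quartic_ne_two_inversions (a 0) (a 1) (a 2) (a 3) ha
          (hne 2 le_rfl le_rfl)
        exact hx (h x)
end

section
/- Let q be an odd prime power, n ≥ 1, and c_0, c_1, ..., c_{n−1} ∈ F_q with c_0 ≠ 0. Define α_0 = 0, α_1 = c_0, β_0 = 1, β_1 = 0, and for k ≥ 2, α_k = c_{k−1}·α_{k−1} + α_{k−2}, β_k = c_{k−1}·β_{k−1} + β_{k−2}, and assume α_n ≠ 0. Suppose F : F_q → F_q is a bijection such that F(c) = (α_{n−1}·c + β_{n−1})/(α_n·c + β_n) + c for every c ∈ F_q outside the set O_n = {−β_i/α_i : 1 ≤ i ≤ n, α_i ≠ 0}. Then n ≥ (q − η((−1)^{n−1}·c_0))/2; in particular n ≥ (q − 1)/2. -/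
open scoped Classical

theorem quadChar_eq_one_or_neg_one {K : Type*} [Field K] {x : K} (hx : x ≠ 0) :
    quadChar x = 1 ∨ quadChar x = -1 := by
  unfold quadChar
  rw [if_neg hx]
  split_ifs <;> simp

theorem card_sq_eq_le_one_add_quadChar {K : Type*} [Field K] [Fintype K] {d : K} (hd : d ≠ 0) :
    ((Finset.univ.filter fun t : K => t * t = d).card : ℤ) ≤ 1 + quadChar d := by
  unfold quadChar
  rw [if_neg hd]
  split_ifs with h
  · obtain ⟨r, rfl⟩ := h
    have hsub : (Finset.univ.filter fun t : K => t * t = r * r) ⊆ {r, -r} := by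
      intro t ht
      simpa [mul_self_eq_mul_self_iff] using ht
    have := (Finset.card_le_card hsub).trans Finset.card_le_two
    omega
  · rw [Finset.filter_eq_empty_iff.mpr fun t _ ht => h ⟨t, ht.symm⟩]
    simp

/-- The fibres of `t ↦ t + d / t` on nonzero elements are the orbits of `t ↦ d / t`, so a set
containing `0` outside of which this map is injective meets every orbit of size two. -/
theorem card_le_of_injOn_add_div {K : Type*} [Field K] [Fintype K] {d : K} (hd : d ≠ 0)
    (T : Finset K) (h0 : 0 ∈ T) (hinj : Set.InjOn (fun t : K => t + d / t) {t | t ∉ T}) :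
    (Fintype.card K : ℤ) - quadChar d ≤ 2 * T.card := by
  have hcover : (Finset.univ : Finset K) ⊆
      insert 0 ((T.erase 0 ∪ (T.erase 0).image (d / ·)) ∪
        Finset.univ.filter fun t : K => t * t = d) := by
    intro t _
    simp only [Finset.mem_insert, Finset.mem_union, Finset.mem_erase, Finset.mem_image,
      Finset.mem_filter, Finset.mem_univ, true_and]
    by_contra! h
    obtain ⟨ht0, ⟨htT, himage⟩, hsq⟩ := h
    have hdt : d / t ∉ T := fun hmem =>
      himage (d / t) ⟨div_ne_zero hd ht0, hmem⟩ (div_div_cancel₀ hd)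
    have heq : t = d / t := hinj (htT ht0) hdt (by
      simp only [div_div_cancel₀ hd]
      ring)
    exact hsq ((eq_div_iff ht0).mp heq)
  have hcard := Finset.card_le_card hcover
  rw [Finset.card_univ] at hcard
  have hinsert := Finset.card_insert_le (0 : K)
    ((T.erase 0 ∪ (T.erase 0).image (d / ·)) ∪ Finset.univ.filter fun t : K => t * t = d)
  have hunion := Finset.card_union_le (T.erase 0 ∪ (T.erase 0).image (d / ·))
    (Finset.univ.filter fun t : K => t * t = d)
  have hunion' := Finset.card_union_le (T.erase 0) ((T.erase 0).image (d / ·))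
  have himage := Finset.card_image_le (s := T.erase 0) (f := (d / ·))
  have herase := Finset.card_erase_add_one h0
  have hfix := card_sq_eq_le_one_add_quadChar hd
  omega

/-- The determinant identity for consecutive convergents. -/
theorem convergents_det {K : Type*} [CommRing K] (c α β : ℕ → K)
    (hα0 : α 0 = 0) (hα1 : α 1 = c 0) (hβ0 : β 0 = 1) (hβ1 : β 1 = 0)
    (hα : ∀ k, 2 ≤ k → α k = c (k - 1) * α (k - 1) + α (k - 2))
    (hβ : ∀ k, 2 ≤ k → β k = c (k - 1) * β (k - 1) + β (k - 2)) (m : ℕ) :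
    α (m + 1) * β m - α m * β (m + 1) = (-1) ^ m * c 0 := by
  induction m with
  | zero => simp [hα0, hα1, hβ0, hβ1]
  | succ m ih =>
    have ha : α (m + 2) = c (m + 1) * α (m + 1) + α m := hα (m + 2) (by omega)
    have hb : β (m + 2) = c (m + 1) * β (m + 1) + β m := hβ (m + 2) (by omega)
    rw [show m + 1 + 1 = m + 2 from rfl, ha, hb, pow_succ]
    linear_combination -ih

/-- Odd `q`: if a bijection `F` of `F_q` agrees with
`c ↦ (α_{n-1} c + β_{n-1})/(α_n c + β_n) + c` outside the pole set
`O_n = {-β_i/α_i : 1 ≤ i ≤ n, α_i ≠ 0}` (convergents built from `c_0 ≠ 0, c_1, …, c_{n-1}`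
with `α_n ≠ 0`), then `n ≥ (q - η((-1)^{n-1} c_0))/2`; in particular `n ≥ (q-1)/2`. -/
theorem carlitz_rank_lower_bound_odd
    (q : ℕ) (hodd : Odd q)
    (K : Type*) [Field K] [Fintype K] (hcard : Fintype.card K = q)
    (n : ℕ) (hn : 1 ≤ n) (c : ℕ → K) (hc0 : c 0 ≠ 0)
    (α β : ℕ → K)
    (hα0 : α 0 = 0) (hα1 : α 1 = c 0) (hβ0 : β 0 = 1) (hβ1 : β 1 = 0)
    (hα : ∀ k, 2 ≤ k → α k = c (k - 1) * α (k - 1) + α (k - 2))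
    (hβ : ∀ k, 2 ≤ k → β k = c (k - 1) * β (k - 1) + β (k - 2))
    (hαn : α n ≠ 0)
    (F : K → K) (hF : Function.Bijective F)
    (hFeq : ∀ x : K, x ∉ {y : K | ∃ i, 1 ≤ i ∧ i ≤ n ∧ α i ≠ 0 ∧ y = -β i / α i} →
      F x = (α (n - 1) * x + β (n - 1)) / (α n * x + β n) + x) :
    ((q : ℤ) - quadChar ((-1 : K) ^ (n - 1) * c 0)) / 2 ≤ (n : ℤ) ∧ (q - 1) / 2 ≤ n := by
  obtain ⟨m, rfl⟩ : ∃ m, n = m + 1 := ⟨n - 1, by omega⟩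
  simp only [Nat.add_sub_cancel] at hFeq ⊢
  have hdet := convergents_det c α β hα0 hα1 hβ0 hβ1 hα hβ m
  set d : K := (-1) ^ m * c 0 with hd_def
  have hd : d ≠ 0 := mul_ne_zero (pow_ne_zero _ (neg_ne_zero.mpr one_ne_zero)) hc0
  set a := α (m + 1)
  set b := β (m + 1)
  let T : Finset K := (Finset.Icc 1 (m + 1)).image fun i => a * (-β i / α i) + b
  have hT : T.card ≤ m + 1 := by
    simpa using Finset.card_image_le (s := Finset.Icc 1 (m + 1))
      (f := fun i => a * (-β i / α i) + b)
  have h0 : (0 : K) ∈ T := Finset.mem_image.mpr ⟨m + 1, by simp, by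
    change a * (-b / a) + b = 0
    rw [mul_div_cancel₀ _ hαn]
    ring⟩
  have hval : ∀ t ∉ T, F ((t - b) / a) = (t + d / t) / a + (α m - b) / a := by
    intro t ht
    have ht0 : t ≠ 0 := fun h => ht (h ▸ h0)
    have hlin : a * ((t - b) / a) + b = t := by
      rw [mul_div_cancel₀ _ hαn]
      ring
    rw [hFeq, hlin]
    · field_simp
      linear_combination hdet
    · rintro ⟨i, hi1, hi2, -, hi⟩
      exact ht (Finset.mem_image.mpr ⟨i, Finset.mem_Icc.mpr ⟨hi1, hi2⟩, by
        simp only [← hi, hlin]⟩)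
  have hinj : Set.InjOn (fun t : K => t + d / t) {t | t ∉ T} := by
    intro s hs t ht hst
    have hF' : F ((s - b) / a) = F ((t - b) / a) := by
      rw [hval s hs, hval t ht, show s + d / s = t + d / t from hst]
    exact sub_left_injective ((div_left_inj' hαn).mp (hF.injective hF'))
  have hbound := card_le_of_injOn_add_div hd T h0 hinj
  rw [hcard] at hbound
  rcases quadChar_eq_one_or_neg_one hd with h | h <;> rw [h] at hbound ⊢ <;>
    constructor <;> omega
end

section
/- Let q be a power of 2, n ≥ 1, and c_0, c_1, ..., c_{n−1} ∈ F_q with c_0 ≠ 0. Define α_0 = 0, α_1 = c_0, β_0 = 1, β_1 = 0, and for k ≥ 2, α_k = c_{k−1}·α_{k−1} + α_{k−2}, β_k = c_{k−1}·β_{k−1} + β_{k−2}, and assume α_n ≠ 0. Suppose F : F_q → F_q is a bijection such that F(c) = (α_{n−1}·c + β_{n−1})/(α_n·c + β_n) + c for every c ∈ F_q outside the set O_n = {−β_i/α_i : 1 ≤ i ≤ n, α_i ≠ 0}. Then n ≥ q/2. -/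
theorem convergents_det_ne_zero {K : Type*} [Field K] (c α β : ℕ → K) (hc0 : c 0 ≠ 0)
    (hα0 : α 0 = 0) (hα1 : α 1 = c 0) (hβ0 : β 0 = 1)
    (hα : ∀ k, 2 ≤ k → α k = c (k - 1) * α (k - 1) + α (k - 2))
    (hβ : ∀ k, 2 ≤ k → β k = c (k - 1) * β (k - 1) + β (k - 2)) (k : ℕ) :
    α k * β (k + 1) - α (k + 1) * β k ≠ 0 := by
  induction k with
  | zero => simpa [hα0, hα1, hβ0] using hc0
  | succ k ih =>
    have h1 : α (k + 2) = c (k + 1) * α (k + 1) + α k := hα (k + 2) (by omega)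
    have h2 : β (k + 2) = c (k + 1) * β (k + 1) + β k := hβ (k + 2) (by omega)
    rw [show k + 1 + 1 = k + 2 from rfl, h1, h2]
    intro h
    exact ih (by linear_combination -h)

/-- In characteristic two, `x ↦ (a * x + b) / (d * x + e) + x` takes the same value at two points
exchanged by the involution `x ↦ γ / (x + e / d) + e / d`, where `γ = (a * e - d * b) / d ^ 2`. -/
theorem mobius_add_self_eq_of_mul_eq {K : Type*} [Field K] [CharP K 2] {a b d e x y : K}
    (hd : d ≠ 0) (hx : x + e / d ≠ 0) (hy : y + e / d ≠ 0)
    (hxy : (x + e / d) * (y + e / d) = (a * e - d * b) / d ^ 2) :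
    (a * x + b) / (d * x + e) + x = (a * y + b) / (d * y + e) + y := by
  have hx' : d * x + e ≠ 0 := fun h => hx (by field_simp; linear_combination h)
  have hy' : d * y + e ≠ 0 := fun h => hy (by field_simp; linear_combination h)
  have h2 : (2 : K) = 0 := CharTwo.two_eq_zero
  have h : (d * x + e) * (d * y + e) = a * e - d * b := by
    field_simp at hxy
    linear_combination hxy
  rw [← sub_eq_zero]
  have key : (a * x + b) / (d * x + e) + x - ((a * y + b) / (d * y + e) + y) =
      (x - y) * (a * e - d * b + (d * x + e) * (d * y + e)) / ((d * x + e) * (d * y + e)) := by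
    rw [div_add' _ _ _ hx', div_add' _ _ _ hy', div_sub_div _ _ hx' hy']
    congr 1
    ring
  rw [key, h, ← two_mul, h2]
  simp

/-- In characteristic two, an exceptional set containing the pole, outside of which
`x ↦ (a * x + b) / (d * x + e) + x` is injective, has at least half of all elements. -/
theorem card_le_two_mul_card_of_injOn_mobius_add_self {K : Type*} [Field K] [Fintype K]
    [CharP K 2] {a b d e : K} (hd : d ≠ 0) (hdet : a * e - d * b ≠ 0) (O : Finset K)
    (hpole : e / d ∈ O)
    (hinj : Set.InjOn (fun x => (a * x + b) / (d * x + e) + x) {x | x ∉ O}) :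
    Fintype.card K ≤ 2 * O.card := by
  classical
  set δ := e / d with hδ
  set γ := (a * e - d * b) / d ^ 2 with hγ
  have hγ0 : γ ≠ 0 := div_ne_zero hdet (pow_ne_zero _ hd)
  have hne : ∀ x, x ∉ O → x + δ ≠ 0 := fun x hx h => by
    rw [CharTwo.add_eq_zero] at h
    exact hx (h ▸ hpole)
  have hsub : ∀ z : K, z + δ + δ = z := fun z => by rw [add_assoc, CharTwo.add_self_eq_zero, add_zero]
  have hcard : Oᶜ.card ≤ O.card := by
    refine Finset.card_le_card_of_injOn
      (fun x => if (x + δ) ^ 2 = γ then δ else γ / (x + δ) + δ) ?_ ?_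
    · intro x hx
      have hx : x ∉ O := by simpa using hx
      have hx0 := hne x hx
      by_cases hs : (x + δ) ^ 2 = γ
      · simpa [hs] using hpole
      · simp only [hs, if_false]
        by_contra hy
        refine hs ?_
        have hmul : (x + δ) * (γ / (x + δ) + δ + δ) = γ := by
          rw [hsub, mul_div_cancel₀ _ hx0]
        have hxy : x = γ / (x + δ) + δ :=
          hinj hx hy (mobius_add_self_eq_of_mul_eq hd hx0 (hne _ hy) hmul)
        rw [← hxy] at hmul
        rw [sq, hmul]
    · intro x hx y hy hxy
      have hx0 := hne x (by simpa using hx)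
      have hy0 := hne y (by simpa using hy)
      by_cases hs : (x + δ) ^ 2 = γ <;> by_cases ht : (y + δ) ^ 2 = γ <;>
        simp only [hs, ht, if_true, if_false] at hxy
      · exact add_right_cancel (CharTwo.sq_injective (hs.trans ht.symm))
      · exact absurd (right_eq_add.mp hxy |>.symm ▸ rfl) (div_ne_zero hγ0 hy0)
      · exact absurd (add_eq_right.mp hxy) (div_ne_zero hγ0 hx0)
      · have h := add_right_cancel hxy
        rw [div_eq_div_iff hx0 hy0] at h
        exact add_right_cancel (mul_left_cancel₀ hγ0 h).symm
  have := O.card_add_card_compl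
  omega


/-- `q` a power of `2`: if a bijection `F` of `F_q` agrees with
`c ↦ (α_{n-1} c + β_{n-1})/(α_n c + β_n) + c` outside the pole set
`O_n = {-β_i/α_i : 1 ≤ i ≤ n, α_i ≠ 0}` (convergents built from `c_0 ≠ 0, c_1, …, c_{n-1}`
with `α_n ≠ 0`), then `n ≥ q/2`. -/
theorem carlitz_rank_lower_bound_char_two
    (q : ℕ) (hq2 : ∃ m : ℕ, q = 2 ^ m)
    (K : Type*) [Field K] [Fintype K] (hcard : Fintype.card K = q)
    (n : ℕ) (hn : 1 ≤ n) (c : ℕ → K) (hc0 : c 0 ≠ 0)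
    (α β : ℕ → K)
    (hα0 : α 0 = 0) (hα1 : α 1 = c 0) (hβ0 : β 0 = 1) (hβ1 : β 1 = 0)
    (hα : ∀ k, 2 ≤ k → α k = c (k - 1) * α (k - 1) + α (k - 2))
    (hβ : ∀ k, 2 ≤ k → β k = c (k - 1) * β (k - 1) + β (k - 2))
    (hαn : α n ≠ 0)
    (F : K → K) (hF : Function.Bijective F)
    (hFeq : ∀ x : K, x ∉ {y : K | ∃ i, 1 ≤ i ∧ i ≤ n ∧ α i ≠ 0 ∧ y = -β i / α i} →
      F x = (α (n - 1) * x + β (n - 1)) / (α n * x + β n) + x) :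
    q / 2 ≤ n := by
  classical
  obtain ⟨m, rfl⟩ := hq2
  have : Fact (Nat.Prime 2) := ⟨Nat.prime_two⟩
  have : CharP K 2 := charP_of_card_eq_prime_pow hcard
  obtain ⟨k, rfl⟩ : ∃ k, n = k + 1 := ⟨n - 1, by omega⟩
  have hdet := convergents_det_ne_zero c α β hc0 hα0 hα1 hβ0 hα hβ k
  let O : Finset K := (Finset.Icc 1 (k + 1)).image fun i => -β i / α i
  have hO : O.card ≤ k + 1 := Finset.card_image_le.trans (by simp)
  have hF' : ∀ x ∉ O, F x = (α k * x + β k) / (α (k + 1) * x + β (k + 1)) + x := by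
    refine fun x hx => hFeq x fun ⟨i, hi1, hin, _, hxi⟩ => hx ?_
    exact Finset.mem_image.mpr ⟨i, Finset.mem_Icc.mpr ⟨hi1, hin⟩, hxi.symm⟩
  have hle := card_le_two_mul_card_of_injOn_mobius_add_self hαn hdet O
    (Finset.mem_image.mpr ⟨k + 1, by simp, by rw [CharTwo.neg_eq]⟩)
    (fun x hx y hy hxy => hF.injective ((hF' x hx).trans (hxy.trans (hF' y hy).symm)))
  omega
end
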